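/- (Brezis–Gallouet inequality.) There exists a constant C > 0 such that for every mean-free vector field u ∈ H²(𝕋²) with u ≠ 0 and ‖Δu‖_{L²} ≥ λ₁ ‖u‖_{H¹}, one has ‖u‖_{L^∞} ≤ C ‖u‖_{H¹} (1 + log(‖Δu‖_{L²}/(λ₁ ‖u‖_{H¹})))^{1/2}. -/

import Mathlib

open MeasureTheory Filter
open scoped RealInnerProductSpace Topology

noncomputable section

abbrev E2 := EuclideanSpace ℝ (Fin 2)

/-- The fundamental domain (unit square) of the torus `𝕋² = ℝ²/ℤ²`. -/
def cube : Set E2 := {x | ∀ i, x i ∈ Set.Icc (0:ℝ) 1}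

/-- The `i`-th standard basis vector of `ℝ²`. -/
def e2 (i : Fin 2) : E2 := EuclideanSpace.single i 1

/-- `ℤ²`-periodicity of a vector field (periodicity under unit coordinate translations). -/
def PeriodicVF (u : E2 → E2) : Prop := ∀ (x : E2) (i : Fin 2), u (x + e2 i) = u x

/-- `ℤ²`-periodicity of a scalar field. -/
def PeriodicF (p : E2 → ℝ) : Prop := ∀ (x : E2) (i : Fin 2), p (x + e2 i) = p x

/-- Partial derivative of a vector field in the `i`-th coordinate direction. -/
def pdir (u : E2 → E2) (i : Fin 2) (x : E2) : E2 := fderiv ℝ u x (e2 i)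

/-- Divergence of a vector field. -/
def divg (u : E2 → E2) (x : E2) : ℝ := ∑ i, pdir u i x i

def DivFree (u : E2 → E2) : Prop := ∀ x, divg u x = 0

def MeanFree (u : E2 → E2) : Prop := (∫ x in cube, u x) = 0

/-- Componentwise Laplacian. -/
def lap (u : E2 → E2) (x : E2) : E2 := ∑ i, pdir (pdir u i) i x

/-- The `L²` norm on the torus (integral over the fundamental domain). -/
def L2 (u : E2 → E2) : ℝ := Real.sqrt (∫ x in cube, ‖u x‖ ^ 2)

/-- The `L²` norm of the gradient `‖∇u‖_{L²}`. -/
def gradL2 (u : E2 → E2) : ℝ := Real.sqrt (∫ x in cube, ∑ i, ‖pdir u i x‖ ^ 2)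

/-- `‖Δu‖_{L²}`. -/
def lapL2 (u : E2 → E2) : ℝ := L2 (lap u)

/-- The `L^∞` norm (for continuous periodic fields). -/
def Linf (u : E2 → E2) : ℝ := ⨆ x : E2, ‖u x‖

/-- Full Sobolev `H^k` norm on the torus. -/
def Hnorm (k : ℕ) (u : E2 → E2) : ℝ :=
  Real.sqrt (∑ j ∈ Finset.range (k+1), ∫ x in cube, ‖iteratedFDeriv ℝ j u x‖ ^ 2)

/-- The trilinear form `b(u,v,w) = ∫ ((u·∇)v)·w dx`. -/
def triB (u v w : E2 → E2) : ℝ := ∫ x in cube, ⟪fderiv ℝ v x (u x), w x⟫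

/-- The smallest eigenvalue of the Stokes operator on `𝕋²`. -/
def lam1 : ℝ := 4 * Real.pi ^ 2

/-- The Grashof number. -/
def grashof (ν : ℝ) (f : E2 → E2) : ℝ := L2 f / (ν ^ 2 * lam1)

/-- An interpolant operator satisfying `‖φ − I_h φ‖_{L²} ≤ c₁ h ‖∇φ‖_{L²}` on `H¹` fields. -/
def InterpBound (Ih : (E2 → E2) →ₗ[ℝ] (E2 → E2)) (c₁ h : ℝ) : Prop :=
  ∀ φ : E2 → E2, ContDiff ℝ 1 φ → PeriodicVF φ →
    L2 (fun x => φ x - Ih φ x) ≤ c₁ * h * gradL2 φ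

/-- The 2D Navier–Stokes equations at time `t`. -/
def NSEeq (ν : ℝ) (f : E2 → E2) (u : ℝ → E2 → E2) (p : ℝ → E2 → ℝ) (t : ℝ) : Prop :=
  ∀ x, deriv (fun s => u s x) t + fderiv ℝ (u t) x (u t x) + gradient (p t) x
      = ν • lap (u t) x + f x

/-- The data-assimilation Navier–Stokes–Voigt equations at time `t`. -/
def VoigtEq (ν α μ : ℝ) (f : E2 → E2) (Ih : (E2 → E2) →ₗ[ℝ] (E2 → E2))
    (u v : ℝ → E2 → E2) (q : ℝ → E2 → ℝ) (t : ℝ) : Prop :=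
  ∀ x, deriv (fun s => v s x) t - α ^ 2 • lap (fun y => deriv (fun s => v s y) t) x
      + fderiv ℝ (v t) x (v t x) + gradient (q t) x
      = ν • lap (v t) x + f x + μ • (Ih (u t) x - Ih (v t) x)

/-- `u` is a classical solution of 2D NSE (with pressure `p`) on the time set `s`. -/
def IsNSESolOn (ν : ℝ) (f : E2 → E2) (u : ℝ → E2 → E2) (p : ℝ → E2 → ℝ) (s : Set ℝ) : Prop :=
  ContDiff ℝ (⊤:ℕ∞) (Function.uncurry u) ∧
  (∀ t, PeriodicVF (u t) ∧ DivFree (u t) ∧ MeanFree (u t)) ∧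
  (∀ t, PeriodicF (p t)) ∧
  ∀ t ∈ s, NSEeq ν f u p t

/-- `v` is a classical solution of the data-assimilation NSV system (with pressure `q`),
driven by observations of `u` through `Ih`, on the time set `s`. -/
def IsVoigtSolOn (ν α μ : ℝ) (f : E2 → E2) (Ih : (E2 → E2) →ₗ[ℝ] (E2 → E2))
    (u v : ℝ → E2 → E2) (q : ℝ → E2 → ℝ) (s : Set ℝ) : Prop :=
  ContDiff ℝ (⊤:ℕ∞) (Function.uncurry v) ∧
  (∀ t, PeriodicVF (v t) ∧ DivFree (v t) ∧ MeanFree (v t)) ∧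
  (∀ t, PeriodicF (q t)) ∧
  ∀ t ∈ s, VoigtEq ν α μ f Ih u v q t


/-! ### Lattice sums -/

lemma tail_cube_sum (N : ℕ) (hN : 1 ≤ N) (M : ℕ) :
    ∑ m ∈ Finset.Ioc N M, (1:ℝ) / (m:ℝ)^3 ≤ 1 / (2 * N * (N+1)) := by
  have key : ∀ M, N ≤ M → ∑ m ∈ Finset.Ioc N M, (1:ℝ) / (m:ℝ)^3
      ≤ 1 / (2 * N * (N+1)) - 1 / (2 * M * (M+1)) := by
    intro M hM
    induction M, hM using Nat.le_induction with
    | base => simp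
    | succ n hn ih =>
      rw [Finset.sum_Ioc_succ_top hn]
      have hn1 : (1:ℝ) ≤ n := by exact_mod_cast hN.trans hn
      have : (1:ℝ) / ((n+1 : ℕ):ℝ)^3 ≤ 1 / (2 * n * (n+1)) -
          1 / (2 * ((n+1:ℕ):ℝ) * (((n+1:ℕ):ℝ)+1)) := by
        push_cast
        have e : (1:ℝ) / (2 * n * (n+1)) - 1 / (2 * ((n:ℝ)+1) * ((n:ℝ)+1+1))
            = 1 / (n * (n+1) * (n+2)) := by
          field_simp
          ring
        rw [e]
        apply one_div_le_one_div_of_le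
        · positivity
        · nlinarith
      linarith
  rcases le_total N M with h | h
  · refine (key M h).trans ?_
    have : (0:ℝ) ≤ 1 / (2 * M * (M+1)) := by positivity
    linarith
  · rw [Finset.Ioc_eq_empty (by omega)]
    simp only [Finset.sum_empty]
    positivity

lemma radial_sum (R : ℝ) (hR : 1 ≤ R) (M : ℕ) :
    ∑ m ∈ Finset.Icc 1 M, (1:ℝ) / (m * (1 + (m:ℝ)^2 / R^2)) ≤ 2 + Real.log R := by
  set N := ⌊R⌋₊ with hNdef
  have hN : 1 ≤ N := Nat.one_le_floor_iff _ |>.2 hR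
  have hR0 : 0 < R := by linarith
  have hRN : R < N + 1 := Nat.lt_floor_add_one R
  have hsub : Finset.Icc 1 M ⊆ Finset.Icc 1 N ∪ Finset.Ioc N M := by
    intro m hm
    simp only [Finset.mem_union, Finset.mem_Icc, Finset.mem_Ioc] at *
    omega
  have h1 : ∑ m ∈ Finset.Icc 1 N, (1:ℝ) / (m * (1 + (m:ℝ)^2 / R^2)) ≤ 1 + Real.log R := by
    have h := harmonic_floor_le_one_add_log R hR
    refine le_trans ?_ h
    rw [harmonic_eq_sum_Icc]
    push_cast
    apply Finset.sum_le_sum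
    intro m hm
    have hm1 : (1:ℝ) ≤ m := by exact_mod_cast (Finset.mem_Icc.1 hm).1
    rw [← one_div]
    apply one_div_le_one_div_of_le (by linarith)
    have : 0 ≤ (m:ℝ)^2 / R^2 := by positivity
    nlinarith
  have h2 : ∑ m ∈ Finset.Ioc N M, (1:ℝ) / (m * (1 + (m:ℝ)^2 / R^2)) ≤ 1 := by
    have : ∀ m ∈ Finset.Ioc N M, (1:ℝ) / (m * (1 + (m:ℝ)^2 / R^2)) ≤ R^2 * (1 / (m:ℝ)^3) := by
      intro m hm
      have hm1 : (1:ℝ) ≤ m := by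
        have := (Finset.mem_Ioc.1 hm).1
        exact_mod_cast (by omega : 1 ≤ m)
      rw [mul_one_div, div_le_div_iff₀ (by positivity) (by positivity)]
      have : R^2 * (m * (1 + (m:ℝ)^2 / R^2)) = R^2 * m + m^3 := by
        field_simp
      rw [this]
      have : 0 ≤ R^2 * (m:ℝ) := by positivity
      linarith
    refine (Finset.sum_le_sum this).trans ?_
    rw [← Finset.mul_sum]
    have hN1 : (1:ℝ) ≤ N := by exact_mod_cast hN
    calc R^2 * _ ≤ R^2 * (1 / (2 * N * (N+1))) := by
          gcongr
          exact tail_cube_sum N hN M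
      _ ≤ 1 := by
          rw [mul_one_div, div_le_one (by positivity)]
          nlinarith
  calc _ ≤ ∑ m ∈ Finset.Icc 1 N ∪ Finset.Ioc N M, (1:ℝ) / (m * (1 + (m:ℝ)^2 / R^2)) := by
        apply Finset.sum_le_sum_of_subset_of_nonneg hsub
        intros; positivity
    _ ≤ ∑ m ∈ Finset.Icc 1 N, (1:ℝ) / (m * (1 + (m:ℝ)^2 / R^2)) +
        ∑ m ∈ Finset.Ioc N M, (1:ℝ) / (m * (1 + (m:ℝ)^2 / R^2)) := by
        rw [← Finset.sum_union_inter]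
        have : 0 ≤ ∑ m ∈ Finset.Icc 1 N ∩ Finset.Ioc N M,
          (1:ℝ) / (m * (1 + (m:ℝ)^2 / R^2)) := Finset.sum_nonneg (by intros; positivity)
        linarith
    _ ≤ _ := by linarith

/-- Square length of a frequency. -/
def ksq (k : Fin 2 → ℤ) : ℝ := (k 0 : ℝ)^2 + (k 1 : ℝ)^2

/-- Sup norm of a frequency. -/
def kmax (k : Fin 2 → ℤ) : ℕ := max (k 0).natAbs (k 1).natAbs

lemma kmax_sq_le (k : Fin 2 → ℤ) : (kmax k : ℝ)^2 ≤ ksq k := by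
  unfold kmax ksq
  rcases max_choice (k 0).natAbs (k 1).natAbs with h | h
  · rw [h, Nat.cast_natAbs, Int.cast_abs, sq_abs]
    nlinarith [sq_nonneg ((k 1 : ℤ) : ℝ)]
  · rw [h, Nat.cast_natAbs, Int.cast_abs, sq_abs]
    nlinarith [sq_nonneg ((k 0 : ℤ) : ℝ)]

lemma kmax_pos (k : Fin 2 → ℤ) (hk : k ≠ 0) : 1 ≤ kmax k := by
  unfold kmax
  by_contra h
  apply hk
  funext i
  fin_cases i <;> simp <;> omega

lemma card_shell (S : Finset (Fin 2 → ℤ)) (m : ℕ) (hm : 1 ≤ m) :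
    (S.filter (fun k => kmax k = m)).card ≤ 8 * m := by
  rw [← Int.card_box (by omega : m ≠ 0)]
  apply Finset.card_le_card_of_injOn (fun k => (k 0, k 1))
  · intro k hk
    simp only [Finset.coe_filter, Set.mem_ofPred_eq] at hk
    simpa [kmax] using hk.2
  · intro a _ b _ hab
    simp only [Prod.mk.injEq] at hab
    funext i
    fin_cases i
    · exact hab.1
    · exact hab.2

lemma lattice_sum (R : ℝ) (hR : 1 ≤ R) (S : Finset (Fin 2 → ℤ)) (hS : ∀ k ∈ S, k ≠ 0) :
    ∑ k ∈ S, 1 / (ksq k * (1 + ksq k / R^2)) ≤ 8 * (2 + Real.log R) := by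
  have hR0 : 0 < R := by linarith
  have h1 : ∀ k ∈ S, 1 / (ksq k * (1 + ksq k / R^2)) ≤
      1 / ((kmax k:ℝ)^2 * (1 + (kmax k:ℝ)^2 / R^2)) := by
    intro k hk
    have h := kmax_sq_le k
    have h2 : (1:ℝ) ≤ kmax k := by exact_mod_cast kmax_pos k (hS k hk)
    apply one_div_le_one_div_of_le
    · positivity
    · have h3 : 0 ≤ ksq k := by unfold ksq; positivity
      gcongr
  refine (Finset.sum_le_sum h1).trans ?_
  set M := S.sup kmax
  have hmap : ∀ k ∈ S, kmax k ∈ Finset.Icc 1 M := fun k hk =>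
    Finset.mem_Icc.2 ⟨kmax_pos k (hS k hk), Finset.le_sup hk⟩
  rw [← Finset.sum_fiberwise_of_maps_to hmap]
  calc _ ≤ ∑ m ∈ Finset.Icc 1 M, 8 * ((1:ℝ) / (m * (1 + (m:ℝ)^2 / R^2))) := by
        apply Finset.sum_le_sum
        intro m hm
        have hm1 := (Finset.mem_Icc.1 hm).1
        have hm1' : (1:ℝ) ≤ m := by exact_mod_cast hm1
        rw [Finset.sum_congr rfl (g := fun _ => 1 / ((m:ℝ)^2 * (1 + (m:ℝ)^2 / R^2)))
          (fun k hk => by rw [(Finset.mem_filter.1 hk).2])]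
        rw [Finset.sum_const, nsmul_eq_mul]
        have hc : ((S.filter (fun k => kmax k = m)).card : ℝ) ≤ 8 * m := by
          exact_mod_cast card_shell S m hm1
        calc _ ≤ (8 * m : ℝ) * (1 / ((m:ℝ)^2 * (1 + (m:ℝ)^2 / R^2))) := by gcongr
          _ = _ := by field_simp
    _ = 8 * ∑ m ∈ Finset.Icc 1 M, ((1:ℝ) / (m * (1 + (m:ℝ)^2 / R^2))) := by
        rw [Finset.mul_sum]
    _ ≤ _ := by
        gcongr
        exact radial_sum R hR M

/-! ### Fourier analysis on the torus -/

local instance instMSCircle : MeasureSpace UnitAddCircle := ⟨AddCircle.haarAddCircle⟩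

local instance instHaarCircle : Measure.IsAddHaarMeasure (volume : Measure UnitAddCircle) :=
  inferInstanceAs (Measure.IsAddHaarMeasure AddCircle.haarAddCircle)

local instance instProbCircle : IsProbabilityMeasure (volume : Measure UnitAddCircle) :=
  inferInstanceAs (IsProbabilityMeasure AddCircle.haarAddCircle)

/-- Periodicity for general codomain. -/
def Per {α : Type} (g : E2 → α) : Prop := ∀ (x : E2) (i : Fin 2), g (x + e2 i) = g x

/-- Projection to the torus. -/
def toT (x : E2) : UnitAddTorus (Fin 2) := fun i => (x i : UnitAddCircle)

lemma Per.int {α : Type} {g : E2 → α} (hg : Per g) (i : Fin 2) (n : ℤ) (x : E2) :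
    g (x + (n:ℝ) • e2 i) = g x := by
  induction n using Int.induction_on with
  | zero => simp
  | succ n ih =>
    have : x + (((n:ℤ) + 1 : ℤ):ℝ) • e2 i = (x + ((n:ℤ):ℝ) • e2 i) + e2 i := by
      push_cast; rw [add_smul, one_smul, add_assoc]
    rw [this, hg, ih]
  | pred n ih =>
    rw [← ih, ← hg (x + ((-(n:ℤ) - 1 : ℤ):ℝ) • e2 i) i]
    congr 1
    push_cast; rw [sub_smul, one_smul]; abel

lemma Per.toT_eq {α : Type} {g : E2 → α} (hg : Per g) {x y : E2} (h : toT x = toT y) :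
    g x = g y := by
  have h' : ∀ i, ∃ n : ℤ, y i = x i + n := by
    intro i
    have := congrFun h i
    simp only [toT] at this
    rw [QuotientAddGroup.eq] at this
    obtain ⟨n, hn⟩ := AddSubgroup.mem_zmultiples_iff.1 this
    refine ⟨n, ?_⟩
    simp at hn
    linarith
  choose n hn using h'
  have : y = (x + ((n 0 : ℤ):ℝ) • e2 0) + ((n 1 : ℤ):ℝ) • e2 1 := by
    ext i
    fin_cases i <;> simp [e2, hn]
  rw [this, hg.int, hg.int]

lemma toT_quot : IsOpenQuotientMap (toT) := by
  have h1 : IsOpenQuotientMap (Pi.map (fun (_ : Fin 2) (x : ℝ) => (x : UnitAddCircle))) :=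
    IsOpenQuotientMap.piMap (fun i => QuotientAddGroup.isOpenQuotientMap_mk)
  have h2 : IsOpenQuotientMap (fun x : E2 => (WithLp.ofLp x : Fin 2 → ℝ)) :=
    (PiLp.homeomorph 2 (fun _ : Fin 2 => ℝ)).isOpenQuotientMap
  exact h1.comp h2

lemma exists_lift (g : E2 → ℂ) (hc : Continuous g) (hg : Per g) :
    ∃ F : C(UnitAddTorus (Fin 2), ℂ), ∀ x, F (toT x) = g x := by
  have key : ∀ x, g (Function.surjInv toT_quot.surjective (toT x)) = g x := fun x =>
    hg.toT_eq (Function.surjInv_eq toT_quot.surjective (toT x))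
  refine ⟨⟨fun t => g (Function.surjInv toT_quot.surjective t), ?_⟩, key⟩
  rw [← toT_quot.continuous_comp_iff]
  convert hc using 1
  funext x
  exact key x

lemma cube_integral {E : Type*} [NormedAddCommGroup E] [NormedSpace ℝ E] (g : E2 → E) :
    ∫ x in cube, g x = ∫ x in Set.Icc (0 : Fin 2 → ℝ) 1, g (WithLp.toLp 2 x) := by
  have h := (PiLp.volume_preserving_toLp (Fin 2)).setIntegral_preimage_emb
    (MeasurableEquiv.toLp 2 (Fin 2 → ℝ)).measurableEmbedding g cube
  rw [← h]
  congr 2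
  ext x
  simp [cube, Set.mem_Icc, Pi.le_def, forall_and]

lemma torus_integral {E : Type*} [NormedAddCommGroup E] [NormedSpace ℝ E]
    (F : UnitAddTorus (Fin 2) → E) : ∫ t, F t = ∫ x in cube, F (toT x) := by
  rw [UnitAddTorus.integral_preimage F 0, cube_integral]
  have : {x : Fin 2 → ℝ | ∀ i, x i ∈ Set.Ioc ((0 : Fin 2 → ℝ) i) ((0 : Fin 2 → ℝ) i + 1)}
      = Set.pi Set.univ (fun i => Set.Ioc ((0 : Fin 2 → ℝ) i) ((1 : Fin 2 → ℝ) i)) := by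
    ext x; simp
  rw [this]
  rw [volume_pi, setIntegral_congr_set Measure.univ_pi_Ioc_ae_eq_Icc]
  rfl

/-- The conjugate character. -/
def ch (k : Fin 2 → ℤ) (x : E2) : ℂ := UnitAddTorus.mFourier (-k) (toT x)

/-- Fourier coefficients. -/
def coef (g : E2 → ℂ) (k : Fin 2 → ℤ) : ℂ := ∫ x in cube, ch k x * g x

lemma coef_eq (g : E2 → ℂ) (F : C(UnitAddTorus (Fin 2), ℂ)) (h : ∀ x, F (toT x) = g x)
    (k : Fin 2 → ℤ) : UnitAddTorus.mFourierCoeff F k = coef g k := by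
  unfold UnitAddTorus.mFourierCoeff coef
  rw [torus_integral]
  simp only [h, ch, smul_eq_mul]

lemma bessel (g : E2 → ℂ) (hc : Continuous g) (hg : Per g) (S : Finset (Fin 2 → ℤ)) :
    ∑ k ∈ S, ‖coef g k‖^2 ≤ ∫ x in cube, ‖g x‖^2 := by
  obtain ⟨F, hF⟩ := exists_lift g hc hg
  have h := UnitAddTorus.hasSum_sq_mFourierCoeff (F.toLp 2 volume ℂ)
  simp only [UnitAddTorus.mFourierCoeff_toLp, coef_eq g F hF] at h
  have e : ∫ t, ‖(F.toLp 2 volume ℂ : UnitAddTorus (Fin 2) → ℂ) t‖^2 = ∫ x in cube, ‖g x‖^2 := by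
    have : ∫ t, ‖(F.toLp 2 volume ℂ : UnitAddTorus (Fin 2) → ℂ) t‖^2 = ∫ t, ‖F t‖^2 := by
      apply integral_congr_ae
      filter_upwards [ContinuousMap.coeFn_toLp (p := 2) (𝕜 := ℂ) volume F] with t ht
      rw [ht]
    rw [this, torus_integral]
    simp only [hF]
  rw [← e]
  exact sum_le_hasSum S (fun _ _ => by positivity) h

lemma inversion_bound (g : E2 → ℂ) (hc : Continuous g) (hg : Per g) (B : ℝ)
    (hB : ∀ S : Finset (Fin 2 → ℤ), ∑ k ∈ S, ‖coef g k‖ ≤ B) (x : E2) : ‖g x‖ ≤ B := by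
  obtain ⟨F, hF⟩ := exists_lift g hc hg
  have hs : Summable (fun k => ‖coef g k‖) := summable_of_sum_le (fun _ => norm_nonneg _) hB
  have hs' : Summable (UnitAddTorus.mFourierCoeff F) := by
    apply Summable.of_norm
    simpa only [coef_eq g F hF] using hs
  have h := UnitAddTorus.hasSum_mFourier_series_apply_of_summable hs' (toT x)
  rw [hF] at h
  rw [← h.tsum_eq]
  refine tsum_of_norm_bounded (g := fun k => ‖coef g k‖) hs.hasSum ?_ |>.trans
    (Real.tsum_le_of_sum_le (fun _ => norm_nonneg _) hB)
  intro k
  rw [norm_smul, coef_eq g F hF]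
  have : ‖UnitAddTorus.mFourier k (toT x)‖ ≤ 1 := by
    exact (ContinuousMap.norm_coe_le_norm (UnitAddTorus.mFourier k) (toT x)).trans
      (UnitAddTorus.mFourier_norm (n := k)).le
  nlinarith [norm_nonneg (coef g k)]

lemma toT_add (x : E2) (i : Fin 2) : toT (x + e2 i) = toT x := by
  funext j
  simp only [toT, e2, PiLp.add_apply, EuclideanSpace.single_apply]
  split_ifs
  · simp
  · simp

lemma ch_per (k : Fin 2 → ℤ) : Per (ch k) := fun x i => by
  simp only [ch, toT_add]

lemma ch_eq (k : Fin 2 → ℤ) (x : E2) :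
    ch k x = Complex.exp (-(2 * Real.pi * Complex.I) * ((k 0 : ℂ) * (x 0 : ℂ) + k 1 * (x 1 : ℂ))) := by
  simp only [ch, UnitAddTorus.mFourier, toT, ContinuousMap.coe_mk, fourier_coe_apply,
    Fin.prod_univ_two, ← Complex.exp_add]
  congr 1
  simp only [Pi.neg_apply]
  push_cast
  ring

lemma ch_contDiff (k : Fin 2 → ℤ) : ContDiff ℝ 2 (ch k) := by
  have : ch k = fun x => Complex.exp (-(2 * Real.pi * Complex.I) *
      ((k 0 : ℂ) * (Complex.ofRealCLM (x 0)) + k 1 * (Complex.ofRealCLM (x 1)))) := by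
    funext x; rw [ch_eq]; rfl
  rw [this]
  apply ContDiff.cexp
  fun_prop

lemma ch_deriv (k : Fin 2 → ℤ) (x : E2) (i : Fin 2) :
    fderiv ℝ (ch k) x (e2 i) = -(2 * Real.pi * Complex.I * k i) * ch k x := by
  have hd : HasFDerivAt (ch k) (fderiv ℝ (ch k) x) x :=
    ((ch_contDiff k).differentiable (by norm_num)).differentiableAt.hasFDerivAt
  have h1 : HasDerivAt (fun t : ℝ => ch k (x + t • e2 i)) (fderiv ℝ (ch k) x (e2 i)) 0 := by
    have := hd.hasLineDerivAt (e2 i)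
    exact this
  have h2 : HasDerivAt (fun t : ℝ => ch k (x + t • e2 i))
      (-(2 * Real.pi * Complex.I * k i) * ch k x) 0 := by
    have e : (fun t : ℝ => ch k (x + t • e2 i)) =
      fun t : ℝ => Complex.exp (-(2 * Real.pi * Complex.I * k i) * (t:ℂ)) * ch k x := by
      funext t
      rw [ch_eq, ch_eq, ← Complex.exp_add]
      congr 1
      fin_cases i <;> simp [e2] <;> ring
    rw [e]
    apply HasDerivAt.mul_const
    have := ((Complex.ofRealCLM.hasDerivAt (x := (0:ℝ))).const_mul
      (-(2 * Real.pi * Complex.I * k i))).cexp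
    simpa using this
  exact h1.unique h2

lemma int_deriv_zero (h : E2 → ℂ) (hh : ContDiff ℝ 1 h) (hp : Per h) (i : Fin 2) :
    ∫ x in cube, fderiv ℝ h x (e2 i) = 0 := by
  rw [cube_integral]
  let L : (Fin 2 → ℝ) ≃L[ℝ] E2 := (PiLp.continuousLinearEquiv 2 ℝ (fun _ : Fin 2 => ℝ)).symm
  have hL : ∀ x, L x = WithLp.toLp 2 x := fun x => rfl
  have hd : ∀ x : Fin 2 → ℝ, HasFDerivAt (fun x => h (L x))
      ((fderiv ℝ h (L x)).comp (L : (Fin 2 → ℝ) →L[ℝ] E2)) x := fun x =>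
    ((hh.differentiable (by norm_num)).differentiableAt.hasFDerivAt).comp x L.hasFDerivAt
  have hLe : ∀ i, L (Pi.single i 1) = e2 i := by
    intro i; rfl
  have hcont : Continuous (fun x => fderiv ℝ h (L x) (e2 i)) :=
    ((hh.continuous_fderiv (by norm_num)).comp L.continuous).clm_apply continuous_const
  have esum : ∀ x : Fin 2 → ℝ, ∑ j, (if j = i then ((fderiv ℝ h (L x)).comp
      (L : (Fin 2 → ℝ) →L[ℝ] E2)) else 0) (Pi.single j 1) = fderiv ℝ h (L x) (e2 i) := by
    intro x
    rw [Finset.sum_eq_single i]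
    · simp [hLe]
    · intro j _ hj; simp [hj]
    · simp
  have key := integral_divergence_of_hasFDerivAt_off_countable' (E := ℂ) (n := 1)
    (0 : Fin 2 → ℝ) 1 (by intro j; simp)
    (fun j x => if j = i then h (L x) else 0)
    (fun j x => if j = i then ((fderiv ℝ h (L x)).comp (L : (Fin 2 → ℝ) →L[ℝ] E2)) else 0)
    ∅ Set.countable_empty
    (by
      intro j
      by_cases hj : j = i
      · simp only [hj, if_true]
        exact (hh.continuous.comp L.continuous).continuousOn
      · simp only [hj, if_false]
        exact continuousOn_const)
    (by
      intro x _ j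
      by_cases hj : j = i
      · simp only [hj, if_true]
        exact hd x
      · simp only [hj, if_false]
        exact hasFDerivAt_const _ _)
    (by
      simp only [esum]
      exact hcont.continuousOn.integrableOn_compact isCompact_Icc)
  simp only [esum] at key
  rw [show (∫ x in Set.Icc (0 : Fin 2 → ℝ) 1, fderiv ℝ h (WithLp.toLp 2 x) (e2 i)) =
    ∫ x in Set.Icc (0 : Fin 2 → ℝ) 1, fderiv ℝ h (L x) (e2 i) from rfl, key]
  apply Finset.sum_eq_zero
  intro j _
  by_cases hj : j = i
  · subst hj
    simp only [if_true]
    rw [sub_eq_zero]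
    congr 1
    funext y
    have : L (j.insertNth ((1 : Fin 2 → ℝ) j) y) = L (j.insertNth ((0 : Fin 2 → ℝ) j) y) + e2 j := by
      rw [← hLe, ← map_add]
      congr 1
      funext l
      refine Fin.succAboveCases j ?_ ?_ l
      · simp
      · intro m; simp
    rw [this, hp]
  · simp [hj]

lemma cube_compact : IsCompact cube := by
  have : cube = (PiLp.homeomorph 2 (fun _ : Fin 2 => ℝ)) ⁻¹' (Set.Icc (0 : Fin 2 → ℝ) 1) := by
    ext x
    have : (PiLp.homeomorph 2 (fun _ : Fin 2 => ℝ)) x = WithLp.ofLp x := rfl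
    simp [cube, Set.mem_Icc, Pi.le_def, forall_and, this]
  rw [this]
  exact (Homeomorph.isCompact_preimage _).2 isCompact_Icc

lemma Continuous.intCube {E : Type*} [NormedAddCommGroup E] {g : E2 → E} (h : Continuous g) :
    IntegrableOn g cube :=
  h.continuousOn.integrableOn_compact cube_compact

lemma coef_deriv (g : E2 → ℂ) (hh : ContDiff ℝ 1 g) (hp : Per g) (i : Fin 2) (k : Fin 2 → ℤ) :
    coef (fun x => fderiv ℝ g x (e2 i)) k = 2 * Real.pi * Complex.I * k i * coef g k := by
  have hck : ContDiff ℝ 1 (ch k) := (ch_contDiff k).of_le (by norm_num)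
  have h0 := int_deriv_zero (fun x => ch k x * g x) (hck.mul hh)
    (fun x j => by simp only [ch_per k x j, hp x j]) i
  have e : ∀ x, fderiv ℝ (fun x => ch k x * g x) x (e2 i) =
      ch k x * fderiv ℝ g x (e2 i) - 2 * Real.pi * Complex.I * k i * (ch k x * g x) := by
    intro x
    rw [fderiv_fun_mul (hck.differentiable (by norm_num)).differentiableAt
      (hh.differentiable (by norm_num)).differentiableAt]
    simp only [add_apply, smul_apply, ch_deriv, smul_eq_mul]
    ring
  simp only [e] at h0
  have hcd : Continuous (fun x => fderiv ℝ g x (e2 i)) :=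
    (hh.continuous_fderiv (by norm_num)).clm_apply continuous_const
  rw [integral_sub, integral_const_mul, sub_eq_zero] at h0
  · exact h0
  · exact (hck.continuous.mul hcd).intCube
  · exact (continuous_const.mul (hck.continuous.mul hh.continuous)).intCube

/-! ### Scalar estimate -/

/-- Scalar Laplacian. -/
def slap (g : E2 → ℂ) (x : E2) : ℂ :=
  ∑ i, fderiv ℝ (fun y => fderiv ℝ g y (e2 i)) x (e2 i)

lemma per_fderiv {F : Type} [NormedAddCommGroup F] [NormedSpace ℝ F] {g : E2 → F} (hp : Per g)
    (v : E2) : Per (fun x => fderiv ℝ g x v) := by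
  intro x i
  have : (fun y => g (y + e2 i)) = g := funext (fun y => hp y i)
  have h2 := fderiv_comp_add_right (𝕜 := ℝ) (f := g) (x := x) (e2 i)
  rw [this] at h2
  simp only [h2]

lemma d1_contDiff (g : E2 → ℂ) (hg : ContDiff ℝ 2 g) (v : E2) :
    ContDiff ℝ 1 (fun x => fderiv ℝ g x v) :=
  (hg.fderiv_right (m := 1) (by norm_num)).clm_apply contDiff_const

lemma coef_slap (g : E2 → ℂ) (hg : ContDiff ℝ 2 g) (hp : Per g) (k : Fin 2 → ℤ) :
    coef (slap g) k = -(4 * Real.pi^2 * ksq k : ℝ) * coef g k := by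
  have h1 : coef (slap g) k =
      ∑ i, coef (fun x => fderiv ℝ (fun y => fderiv ℝ g y (e2 i)) x (e2 i)) k := by
    unfold coef slap
    simp only [Finset.mul_sum]
    rw [integral_finsetSum]
    intro i _
    apply Continuous.intCube
    exact (ch_contDiff k).continuous.mul
      (((d1_contDiff g hg (e2 i)).continuous_fderiv (by norm_num)).clm_apply continuous_const)
  rw [h1, Fin.sum_univ_two]
  rw [coef_deriv _ (d1_contDiff g hg _) (per_fderiv hp _),
    coef_deriv _ (d1_contDiff g hg _) (per_fderiv hp _),
    coef_deriv _ (hg.of_le (by norm_num)) hp, coef_deriv _ (hg.of_le (by norm_num)) hp]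
  unfold ksq
  push_cast
  linear_combination (4 * (Real.pi:ℂ)^2 * ((k 0:ℂ)^2 + (k 1:ℂ)^2) * coef g k) * Complex.I_sq

lemma grad_sum (g : E2 → ℂ) (hg : ContDiff ℝ 2 g) (hp : Per g) (G : ℝ)
    (hG : ∀ i, ∫ x in cube, ‖fderiv ℝ g x (e2 i)‖^2 ≤ G^2) (S : Finset (Fin 2 → ℤ)) :
    ∑ k ∈ S, ksq k * ‖coef g k‖^2 ≤ 2 * G^2 := by
  have hb : ∀ i, ∑ k ∈ S, (k i : ℝ)^2 * ‖coef g k‖^2 ≤ G^2 := by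
    intro i
    refine le_trans ?_ ((bessel _ (d1_contDiff g hg (e2 i)).continuous (per_fderiv hp _) S).trans
      (hG i))
    apply Finset.sum_le_sum
    intro k _
    rw [coef_deriv _ (hg.of_le (by norm_num)) hp]
    have : ‖2 * (Real.pi:ℂ) * Complex.I * (k i:ℂ) * coef g k‖^2 =
        (2 * Real.pi)^2 * ((k i:ℝ)^2 * ‖coef g k‖^2) := by
      simp only [norm_mul, Complex.norm_I, Complex.norm_real, Complex.norm_intCast, Complex.norm_ofNat,
        Real.norm_eq_abs]
      rw [abs_of_pos Real.pi_pos]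
      simp only [mul_pow, sq_abs]
      ring
    rw [this]
    have h1 : 1 ≤ (2 * Real.pi)^2 := by nlinarith [Real.pi_gt_three]
    exact le_mul_of_one_le_left (by positivity) h1
  have e : ∑ k ∈ S, ksq k * ‖coef g k‖^2 =
      ∑ k ∈ S, (k 0 : ℝ)^2 * ‖coef g k‖^2 + ∑ k ∈ S, (k 1 : ℝ)^2 * ‖coef g k‖^2 := by
    rw [← Finset.sum_add_distrib]
    apply Finset.sum_congr rfl
    intro k _
    unfold ksq
    ring
  rw [e]
  linarith [hb 0, hb 1]

lemma lap_sum (g : E2 → ℂ) (hg : ContDiff ℝ 2 g) (hp : Per g) (D : ℝ)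
    (hD : ∫ x in cube, ‖slap g x‖^2 ≤ D^2) (S : Finset (Fin 2 → ℤ)) :
    ∑ k ∈ S, lam1^2 * (ksq k^2 * ‖coef g k‖^2) ≤ D^2 := by
  have hc : Continuous (slap g) := continuous_finsetSum _ (fun i _ =>
    ((d1_contDiff g hg (e2 i)).continuous_fderiv (by norm_num)).clm_apply continuous_const)
  have hper : Per (slap g) := by
    intro x i
    unfold slap
    apply Finset.sum_congr rfl
    intro j _
    exact per_fderiv (per_fderiv hp (e2 j)) (e2 j) x i
  refine le_trans (le_of_eq ?_) ((bessel _ hc hper S).trans hD)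
  apply Finset.sum_congr rfl
  intro k _
  rw [coef_slap g hg hp, norm_mul, norm_neg, Complex.norm_real, mul_pow, Real.norm_eq_abs, sq_abs]
  unfold lam1
  ring

lemma coef_zero (g : E2 → ℂ) (hm : ∫ x in cube, g x = 0) : coef g 0 = 0 := by
  unfold coef
  rw [← hm]
  congr 1
  funext x
  simp [ch_eq]

lemma scalar_bound (g : E2 → ℂ) (hg : ContDiff ℝ 2 g) (hp : Per g)
    (hm : ∫ x in cube, g x = 0) (G D : ℝ) (hG0 : 0 ≤ G) (hle : lam1 * G ≤ D)
    (hG : ∀ i, ∫ x in cube, ‖fderiv ℝ g x (e2 i)‖^2 ≤ G^2)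
    (hD : ∫ x in cube, ‖slap g x‖^2 ≤ D^2) (x : E2) :
    ‖g x‖ ≤ 7 * G * Real.sqrt (1 + Real.log (D / (lam1 * G))) := by
  have hlam : 0 < lam1 := by unfold lam1; positivity
  apply inversion_bound g hg.continuous hp
  intro S
  -- remove the zero frequency
  have hS0 : ∑ k ∈ S, ‖coef g k‖ = ∑ k ∈ S.filter (fun k => k ≠ 0), ‖coef g k‖ := by
    rw [Finset.sum_filter_of_ne]
    intro k _ hk h0
    apply hk
    rw [h0, coef_zero g hm, norm_zero]
  rw [hS0]
  set T := S.filter (fun k => k ≠ 0) with hT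
  have hTne : ∀ k ∈ T, k ≠ 0 := fun k hk => (Finset.mem_filter.1 hk).2
  have hpos : ∀ k ∈ T, 1 ≤ ksq k := by
    intro k hk
    have h1 : (1:ℝ) ≤ kmax k := by exact_mod_cast kmax_pos k (hTne k hk)
    nlinarith [kmax_sq_le k]
  have hgs := grad_sum g hg hp G hG T
  rcases hG0.eq_or_lt with h0 | hGpos
  · rw [← h0] at hgs ⊢
    simp only [mul_zero, zero_mul]
    have hz : ∑ k ∈ T, ksq k * ‖coef g k‖^2 = 0 := le_antisymm (by simpa using hgs)
      (Finset.sum_nonneg (fun k hk => mul_nonneg (by linarith [hpos k hk]) (by positivity)))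
    rw [Finset.sum_eq_zero_iff_of_nonneg
      (fun k hk => mul_nonneg (by linarith [hpos k hk]) (by positivity))] at hz
    apply le_of_eq
    apply Finset.sum_eq_zero
    intro k hk
    have := hz k hk
    have h1 := hpos k hk
    rcases mul_eq_zero.1 this with h | h
    · linarith
    · exact pow_eq_zero_iff (two_ne_zero) |>.1 h
  · set R := D / (lam1 * G) with hR
    have hlG : 0 < lam1 * G := by positivity
    have hR1 : 1 ≤ R := by rw [hR, le_div_iff₀ hlG]; linarith
    have hR0 : 0 < R := by linarith
    have hDR : D = lam1 * G * R := by rw [hR]; field_simp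
    have hls := lap_sum g hg hp D hD T
    have hlog : 0 ≤ Real.log R := Real.log_nonneg hR1
    have hsum := lattice_sum R hR1 T hTne
    have hls' : ∑ k ∈ T, ksq k^2 * ‖coef g k‖^2 ≤ G^2 * R^2 := by
      rw [← Finset.mul_sum, hDR] at hls
      have : lam1^2 * ∑ k ∈ T, ksq k^2 * ‖coef g k‖^2 ≤ lam1^2 * (G^2 * R^2) := by
        linarith [hls, (by ring : (lam1 * G * R)^2 = lam1^2 * (G^2 * R^2))]
      exact le_of_mul_le_mul_left this (by positivity)
    have hw : ∑ k ∈ T, (ksq k * (1 + ksq k / R^2)) * ‖coef g k‖^2 ≤ 3 * G^2 := by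
      have e : ∑ k ∈ T, (ksq k * (1 + ksq k / R^2)) * ‖coef g k‖^2 =
          ∑ k ∈ T, ksq k * ‖coef g k‖^2 + (1 / R^2) * ∑ k ∈ T, ksq k^2 * ‖coef g k‖^2 := by
        rw [Finset.mul_sum, ← Finset.sum_add_distrib]
        apply Finset.sum_congr rfl
        intro k _
        ring
      rw [e]
      have : (1 / R^2) * ∑ k ∈ T, ksq k^2 * ‖coef g k‖^2 ≤ (1 / R^2) * (G^2 * R^2) := by
        gcongr
      have e2 : (1 / R^2) * (G^2 * R^2) = G^2 := by field_simp
      linarith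
    have hcs := Finset.sum_mul_sq_le_sq_mul_sq T
      (fun k => Real.sqrt (1 / (ksq k * (1 + ksq k / R^2))))
      (fun k => Real.sqrt (ksq k * (1 + ksq k / R^2)) * ‖coef g k‖)
    have hwpos : ∀ k ∈ T, 0 < ksq k * (1 + ksq k / R^2) := by
      intro k hk
      have := hpos k hk
      have h1 : 0 < ksq k := by linarith
      positivity
    have e1 : ∑ k ∈ T, Real.sqrt (1 / (ksq k * (1 + ksq k / R^2))) *
        (Real.sqrt (ksq k * (1 + ksq k / R^2)) * ‖coef g k‖) = ∑ k ∈ T, ‖coef g k‖ := by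
      apply Finset.sum_congr rfl
      intro k hk
      have := hwpos k hk
      rw [← mul_assoc, ← Real.sqrt_mul (by positivity), one_div_mul_cancel this.ne', Real.sqrt_one,
        one_mul]
    have e2 : ∑ k ∈ T, Real.sqrt (1 / (ksq k * (1 + ksq k / R^2)))^2 =
        ∑ k ∈ T, 1 / (ksq k * (1 + ksq k / R^2)) := by
      apply Finset.sum_congr rfl
      intro k hk
      have := hwpos k hk
      rw [Real.sq_sqrt (by positivity)]
    have e3 : ∑ k ∈ T, (Real.sqrt (ksq k * (1 + ksq k / R^2)) * ‖coef g k‖)^2 =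
        ∑ k ∈ T, (ksq k * (1 + ksq k / R^2)) * ‖coef g k‖^2 := by
      apply Finset.sum_congr rfl
      intro k hk
      have := hwpos k hk
      rw [mul_pow, Real.sq_sqrt this.le]
    rw [e1, e2, e3] at hcs
    have hfin : (∑ k ∈ T, ‖coef g k‖)^2 ≤ (8 * (2 + Real.log R)) * (3 * G^2) :=
      hcs.trans (mul_le_mul hsum hw
        (Finset.sum_nonneg (fun k hk => mul_nonneg (hwpos k hk).le (by positivity)))
        (by positivity))
    refine (pow_le_pow_iff_left₀ (Finset.sum_nonneg (fun k _ => norm_nonneg _)) (by positivity) two_ne_zero).1 ?_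
    rw [mul_pow, mul_pow, Real.sq_sqrt (by linarith)]
    refine hfin.trans ?_
    nlinarith [mul_nonneg hlog (sq_nonneg G), sq_nonneg G]

/-! ### Components of vector fields -/

/-- Complexified coordinate functional. -/
def compL (j : Fin 2) : E2 →L[ℝ] ℂ :=
  Complex.ofRealCLM.comp (EuclideanSpace.proj j : E2 →L[ℝ] ℝ)

/-- Complexified component. -/
def comp (u : E2 → E2) (j : Fin 2) (x : E2) : ℂ := compL j (u x)

lemma comp_contDiff (u : E2 → E2) (n : ℕ) (hu : ContDiff ℝ n u) (j : Fin 2) :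
    ContDiff ℝ n (comp u j) := (compL j).contDiff.comp hu

lemma comp_per (u : E2 → E2) (hp : PeriodicVF u) (j : Fin 2) : Per (comp u j) :=
  fun x i => by unfold comp; rw [hp x i]

lemma comp_norm_le (u : E2 → E2) (j : Fin 2) (x : E2) : ‖comp u j x‖ ≤ ‖u x‖ := by
  have : ‖comp u j x‖ = ‖u x j‖ := by simp [comp, compL]
  rw [this]
  exact PiLp.norm_apply_le (u x) j

lemma comp_mean (u : E2 → E2) (hu : ContDiff ℝ 2 u) (hm : MeanFree u) (j : Fin 2) :
    ∫ x in cube, comp u j x = 0 := by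
  unfold comp
  rw [ContinuousLinearMap.integral_comp_comm _ hu.continuous.intCube]
  unfold MeanFree at hm
  rw [hm, map_zero]

lemma comp_fderiv (u : E2 → E2) (hu : ContDiff ℝ 1 u) (j i : Fin 2) (x : E2) :
    fderiv ℝ (comp u j) x (e2 i) = comp (pdir u i) j x := by
  have h : HasFDerivAt (comp u j) ((compL j).comp (fderiv ℝ u x)) x :=
    (compL j).hasFDerivAt.comp x
      (hu.differentiable (by norm_num)).differentiableAt.hasFDerivAt
  rw [h.fderiv]
  rfl

lemma pdir_contDiff (u : E2 → E2) (hu : ContDiff ℝ 2 u) (i : Fin 2) : ContDiff ℝ 1 (pdir u i) :=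
  (hu.fderiv_right (m := 1) (by norm_num)).clm_apply contDiff_const

/-- the Brezis–Gallouet inequality on `𝕋²`:
`‖u‖_{L^∞} ≤ C ‖u‖_{H¹} (1 + log(‖Δu‖_{L²}/(λ₁‖u‖_{H¹})))^{1/2}`,
for mean-free `u ∈ H²` with `u ≠ 0` and `‖Δu‖_{L²} ≥ λ₁‖u‖_{H¹}`. -/
theorem brezis_gallouet : ∃ C > (0:ℝ), ∀ u : E2 → E2,
    ContDiff ℝ 2 u → PeriodicVF u → MeanFree u → u ≠ 0 →
    lam1 * gradL2 u ≤ lapL2 u →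
    Linf u ≤ C * gradL2 u * Real.sqrt (1 + Real.log (lapL2 u / (lam1 * gradL2 u))) := by
  refine ⟨14, by norm_num, ?_⟩
  intro u hu hp hm _ hle
  set G := gradL2 u with hGdef
  set D := lapL2 u with hDdef
  have hG0 : 0 ≤ G := Real.sqrt_nonneg _
  have hlam : 0 < lam1 := by unfold lam1; positivity
  have hp1 : ∀ i, ContDiff ℝ 1 (pdir u i) := fun i => pdir_contDiff u hu i
  have hc2 : ∀ i, Continuous (pdir (pdir u i) i) := fun i =>
    ((hp1 i).continuous_fderiv (by norm_num)).clm_apply continuous_const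
  have hcl : Continuous (lap u) := continuous_finsetSum _ (fun i _ => hc2 i)
  have hG2 : ∫ x in cube, ∑ i, ‖pdir u i x‖ ^ 2 = G^2 := by
    rw [hGdef, gradL2, Real.sq_sqrt]
    exact integral_nonneg (fun x => Finset.sum_nonneg (fun i _ => by positivity))
  have hD2 : ∫ x in cube, ‖lap u x‖ ^ 2 = D^2 := by
    rw [hDdef, lapL2, L2, Real.sq_sqrt]
    exact integral_nonneg (fun x => by positivity)
  have hcomp : ∀ j x, ‖comp u j x‖ ≤ 7 * G * Real.sqrt (1 + Real.log (D / (lam1 * G))) := by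
    intro j x
    apply scalar_bound (comp u j) (comp_contDiff u 2 hu j) (comp_per u hp j) (comp_mean u hu hm j)
      G D hG0 hle
    · intro i
      rw [← hG2]
      refine setIntegral_mono_on ?_ ?_ cube_compact.measurableSet ?_
      · have := comp_contDiff (pdir u i) 1 (hp1 i) j
        rw [show (fun x => ‖fderiv ℝ (comp u j) x (e2 i)‖^2) = fun x => ‖comp (pdir u i) j x‖^2 from
          funext (fun x => by rw [comp_fderiv u (hu.of_le (by norm_num)) j i])]
        exact (this.continuous.norm.pow 2).intCube
      · exact (continuous_finsetSum _ (fun i _ => (hp1 i).continuous.norm.pow 2)).intCube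
      · intro y _
        rw [comp_fderiv u (hu.of_le (by norm_num)) j i]
        calc ‖comp (pdir u i) j y‖^2 ≤ ‖pdir u i y‖^2 := by
              gcongr
              exact comp_norm_le _ _ _
          _ ≤ _ := Finset.single_le_sum (f := fun i => ‖pdir u i y‖^2)
              (fun i _ => by positivity) (Finset.mem_univ i)
    · rw [← hD2]
      have e : ∀ y, slap (comp u j) y = comp (lap u) j y := by
        intro y
        unfold slap
        simp only [comp_fderiv u (hu.of_le (by norm_num)) j]
        simp only [comp_fderiv _ (hp1 _) j]
        simp [comp, lap]
      simp only [e]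
      refine setIntegral_mono_on ?_ ?_ cube_compact.measurableSet ?_
      · have : Continuous (comp (lap u) j) := (compL j).continuous.comp hcl
        exact (this.norm.pow 2).intCube
      · exact (hcl.norm.pow 2).intCube
      · intro y _
        gcongr
        exact comp_norm_le _ _ _
  apply ciSup_le
  intro x
  have h0 := hcomp 0 x
  have h1 := hcomp 1 x
  have : ‖u x‖ ≤ ‖comp u 0 x‖ + ‖comp u 1 x‖ := by
    have e0 : ‖comp u 0 x‖ = |u x 0| := by simp [comp, compL]
    have e1 : ‖comp u 1 x‖ = |u x 1| := by simp [comp, compL]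
    rw [e0, e1, EuclideanSpace.norm_eq, Fin.sum_univ_two]
    apply Real.sqrt_le_iff.2 ⟨by positivity, ?_⟩
    simp only [Real.norm_eq_abs]
    nlinarith [mul_nonneg (abs_nonneg (u x 0)) (abs_nonneg (u x 1))]
  linarith
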